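/- arXiv:quant-ph/0508007 — 4 statements merged into one kernel-verified Lean document; each statement's English description precedes it below -/
import Mathlib

section
/- Let N ≥ 2, let X be an N×N Hermitian complex matrix all of whose diagonal entries are zero (X written in the eigenbasis of ρ, traceless and unbiased with respect to ρ), and let ρ = diag(λ₁,…,λ_N) be a diagonal matrix with λ_i ≥ 0 and ∑_i λ_i = 1. For a permutation σ of {1,…,N} let X^σ be the matrix with entries (X^σ)_{ij} = X_{σ(i)σ(j)} (equivalently X^σ = P_σ X P_σ† for the permutation matrix P_σ). Then the sum over all N! permutations σ satisfies ∑_σ Tr[X^σ ρ X^σ ρ] = (N−2)! · Tr[X²] · (1 − Tr[ρ²]). -/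
open Matrix BigOperators

/-- The sum of `f (σ i) (σ j)` over all permutations `σ` is the same for all pairs `i ≠ j`. -/
lemma sum_perm_apply_pair_congr {α M : Type*} [Fintype α] [DecidableEq α] [AddCommMonoid M]
    (f : α → α → M) {i j k l : α} (hij : i ≠ j) (hkl : k ≠ l) :
    ∑ σ : Equiv.Perm α, f (σ i) (σ j) = ∑ σ : Equiv.Perm α, f (σ k) (σ l) := by
  obtain ⟨π, hk, hl⟩ := MulAction.is_two_pretransitive_iff.mp
    (Equiv.Perm.isMultiplyPretransitive α 2) hij hkl
  rw [Equiv.Perm.smul_def] at hk hl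
  rw [← Equiv.sum_comp (Equiv.mulRight π)]
  simp [hk, hl]

/-- For `f` vanishing on the diagonal and `i ≠ j`, each value `f a b` with `a ≠ b` is attained by
`(card α - 2)!` of the terms `f (σ i) (σ j)`. -/
lemma sum_perm_apply_pair {α K : Type*} [Fintype α] [DecidableEq α] [Field K] [CharZero K]
    (f : α → α → K) (hf : ∀ a, f a a = 0) {i j : α} (hij : i ≠ j) :
    ∑ σ : Equiv.Perm α, f (σ i) (σ j) =
      ((Fintype.card α - 2).factorial : K) * ∑ a, ∑ b, f a b := by
  set S := ∑ σ : Equiv.Perm α, f (σ i) (σ j) with hS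
  have total : ∑ a, ∑ b, ∑ σ : Equiv.Perm α, f (σ a) (σ b) =
      ((Fintype.card α).factorial : K) * ∑ a, ∑ b, f a b := by
    have reindex (σ : Equiv.Perm α) : ∑ a, ∑ b, f (σ a) (σ b) = ∑ a, ∑ b, f a b := by
      rw [← Equiv.sum_comp σ (fun a => ∑ b, f a b)]
      exact Finset.sum_congr rfl fun a _ => Equiv.sum_comp σ (f (σ a))
    calc ∑ a, ∑ b, ∑ σ : Equiv.Perm α, f (σ a) (σ b)
        = ∑ σ : Equiv.Perm α, ∑ a, ∑ b, f (σ a) (σ b) := by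
          rw [Finset.sum_comm]
          simp_rw [Finset.sum_comm (t := (Finset.univ : Finset (Equiv.Perm α)))]
          exact Finset.sum_congr rfl fun σ _ => Finset.sum_comm
      _ = _ := by simp [reindex, Fintype.card_perm]
  have entry (a b : α) : ∑ σ : Equiv.Perm α, f (σ a) (σ b) = S - if a = b then S else 0 := by
    split_ifs with h
    · simp [h, hf]
    · rw [sub_zero, hS, sum_perm_apply_pair_congr f h hij]
  have count : ∑ a, ∑ b, ∑ σ : Equiv.Perm α, f (σ a) (σ b) =
      (Fintype.card α : K) * ((Fintype.card α : K) - 1) * S := by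
    simp only [entry, Finset.sum_sub_distrib, Finset.sum_ite_eq, Finset.mem_univ, if_true,
      Finset.sum_const, Finset.card_univ, nsmul_eq_mul]
    ring
  obtain ⟨m, hm⟩ : ∃ m, Fintype.card α = m + 2 :=
    Nat.exists_eq_add_of_le' (Fintype.one_lt_card_iff.mpr ⟨i, j, hij⟩)
  have h := count.symm.trans total
  rw [hm, Nat.factorial_succ, Nat.factorial_succ] at h
  push_cast at h
  rw [hm, Nat.add_sub_cancel]
  have h1 : (m : K) + 1 ≠ 0 := by exact_mod_cast Nat.succ_ne_zero m
  have h2 : (m : K) + 2 ≠ 0 := by exact_mod_cast Nat.succ_ne_zero (m + 1)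
  apply mul_left_cancel₀ (mul_ne_zero h2 h1)
  linear_combination h

/-- For `N ≥ 2`, `X` Hermitian with vanishing diagonal (traceless and
unbiased with respect to `ρ`), and `ρ = diag(λ)` a density matrix written in its own
eigenbasis, the sum over all `N!` permuted observables `X^σ` (with entries
`(X^σ)_{ij} = X_{σ(i)σ(j)}`) satisfies
`∑_σ Tr[X^σ ρ X^σ ρ] = (N−2)! ⬝ Tr[X²] ⬝ (1 − Tr[ρ²])`. -/
theorem sum_perm_trace_eq (N : ℕ) (hN : 2 ≤ N)
    (X : Matrix (Fin N) (Fin N) ℂ) (hX : X.IsHermitian)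
    (hdiag : ∀ i, X i i = 0)
    (lam : Fin N → ℝ) (hlam : ∀ i, 0 ≤ lam i) (hsum : ∑ i, lam i = 1)
    (ρ : Matrix (Fin N) (Fin N) ℂ)
    (hρ : ρ = Matrix.diagonal (fun i => (lam i : ℂ))) :
    ∑ σ : Equiv.Perm (Fin N),
        Matrix.trace ((Matrix.of fun i j => X (σ i) (σ j)) * ρ *
          (Matrix.of fun i j => X (σ i) (σ j)) * ρ)
      = ((N - 2).factorial : ℂ) * Matrix.trace (X * X) * (1 - Matrix.trace (ρ * ρ)) := by
  subst hρ
  set T := ((N - 2).factorial : ℂ) * Matrix.trace (X * X) with hT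
  have entry (i j : Fin N) : ∑ σ : Equiv.Perm (Fin N), X (σ i) (σ j) * X (σ j) (σ i) =
      T - if i = j then T else 0 := by
    split_ifs with h
    · simp [h, hdiag]
    · rw [sum_perm_apply_pair (fun a b => X a b * X b a) (by simp [hdiag]) h]
      simp [hT, Matrix.trace, Matrix.mul_apply]
  have hsum' : ∑ i, (lam i : ℂ) = 1 := by exact_mod_cast hsum
  have expand (σ : Equiv.Perm (Fin N)) :
      Matrix.trace ((Matrix.of fun i j => X (σ i) (σ j)) * Matrix.diagonal (fun i => (lam i : ℂ)) *
        (Matrix.of fun i j => X (σ i) (σ j)) * Matrix.diagonal (fun i => (lam i : ℂ))) =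
      ∑ i, ∑ j, (lam i : ℂ) * lam j * (X (σ i) (σ j) * X (σ j) (σ i)) := by
    simp only [Matrix.trace, Matrix.diag_apply, Matrix.mul_diagonal, Matrix.mul_apply (N := of _),
      Matrix.of_apply, Finset.sum_mul]
    exact Finset.sum_congr rfl fun i _ => Finset.sum_congr rfl fun j _ => by ring
  calc _ = ∑ i, ∑ j, (lam i : ℂ) * lam j *
        ∑ σ : Equiv.Perm (Fin N), X (σ i) (σ j) * X (σ j) (σ i) := by
        simp_rw [expand, Finset.mul_sum]
        rw [Finset.sum_comm]
        exact Finset.sum_congr rfl fun i _ => Finset.sum_comm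
    _ = (∑ i, (lam i : ℂ)) * (∑ j, (lam j : ℂ)) * T - (∑ i, (lam i : ℂ) * lam i) * T := by
        simp only [entry, mul_sub, mul_ite, mul_zero, Finset.sum_sub_distrib, Finset.sum_ite_eq,
          Finset.mem_univ, if_true, Finset.sum_mul, Finset.mul_sum]
        rw [Finset.sum_comm]
    _ = _ := by
        simp only [hsum', Matrix.diagonal_mul_diagonal, Matrix.trace_diagonal]
        ring
end

section
/- Let N ≥ 2, let X be an N×N Hermitian complex matrix with all diagonal entries zero, and let ρ = diag(λ₁,…,λ_N) with λ_i ≥ 0 and ∑_i λ_i = 1. Then there exists a permutation σ of {1,…,N} such that Tr[X^σ ρ X^σ ρ] ≥ (Tr[X²]/(N(N−1))) · (1 − Tr[ρ²]), where (X^σ)_{ij} = X_{σ(i)σ(j)}. -/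
open Matrix BigOperators ComplexOrder

/-- The permutation group of a type acts transitively on pairs of distinct points. -/
theorem Equiv.Perm.exists_apply_eq_and_apply_eq {α : Type*} [DecidableEq α] {i j k l : α}
    (hij : i ≠ j) (hkl : k ≠ l) : ∃ τ : Equiv.Perm α, τ i = k ∧ τ j = l := by
  refine ⟨Equiv.swap (Equiv.swap i k j) l * Equiv.swap i k, ?_, by simp⟩
  have h : k ≠ Equiv.swap i k j := fun h =>
    hij ((Equiv.swap i k).injective (by rw [Equiv.swap_apply_left, ← h]))
  simp [Equiv.swap_apply_of_ne_of_ne h hkl]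

section PermSum

variable {α : Type*} [Fintype α] [DecidableEq α]

/-- The sum of `f (σ i) (σ j)` over all permutations `σ` is the same for all pairs `i ≠ j`. -/
theorem sum_perm_apply_apply_eq (f : α → α → ℝ) {i j k l : α} (hij : i ≠ j) (hkl : k ≠ l) :
    ∑ σ : Equiv.Perm α, f (σ i) (σ j) = ∑ σ : Equiv.Perm α, f (σ k) (σ l) := by
  obtain ⟨τ, rfl, rfl⟩ := Equiv.Perm.exists_apply_eq_and_apply_eq hij hkl
  exact (Fintype.sum_equiv (Equiv.mulRight τ) _ _ fun σ => by simp).symm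

theorem sum_sum_mul_eq_of_offDiag (a g : α → α → ℝ) (C : ℝ) (hg : ∀ i, g i i = 0)
    (hC : ∀ i j, i ≠ j → g i j = C) :
    ∑ i, ∑ j, a i j * g i j = (∑ i, ∑ j, a i j - ∑ i, a i i) * C := by
  have h (i j) : a i j * g i j = a i j * C - if i = j then a i j * C else 0 := by
    split_ifs with hij
    · subst hij; simp [hg]
    · simp [hC i j hij]
  simp only [h, Finset.sum_sub_distrib, Finset.sum_ite_eq, Finset.mem_univ, if_true,
    ← Finset.sum_mul, sub_mul]

/-- The average over all relabellings of a quadratic form with vanishing diagonal, evaluated at a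
vector with entries summing to one. -/
theorem sum_perm_quadratic (f : α → α → ℝ) (hf : ∀ i, f i i = 0)
    (hα : 1 < Fintype.card α) (lam : α → ℝ) (hsum : ∑ i, lam i = 1) :
    ∑ σ : Equiv.Perm α, ∑ i, ∑ j, lam i * lam j * f (σ i) (σ j) =
      Fintype.card (Equiv.Perm α) *
        ((∑ i, ∑ j, f i j) / (Fintype.card α * (Fintype.card α - 1)) *
          (1 - ∑ i, lam i ^ 2)) := by
  obtain ⟨k, l, hkl⟩ := Fintype.exists_pair_of_one_lt_card hα
  have hweighted (a : α → α → ℝ) :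
      ∑ σ : Equiv.Perm α, ∑ i, ∑ j, a i j * f (σ i) (σ j) =
        (∑ i, ∑ j, a i j - ∑ i, a i i) * ∑ σ : Equiv.Perm α, f (σ k) (σ l) := by
    rw [← sum_sum_mul_eq_of_offDiag a (fun i j => ∑ σ : Equiv.Perm α, f (σ i) (σ j)) _
      (fun i => by simp [hf]) fun i j hij => sum_perm_apply_apply_eq f hij hkl, Finset.sum_comm]
    refine Finset.sum_congr rfl fun i _ => ?_
    rw [Finset.sum_comm]
    simp only [Finset.mul_sum]
  have hone := hweighted fun _ _ => 1
  have hinv (σ : Equiv.Perm α) : ∑ i, ∑ j, f (σ i) (σ j) = ∑ i, ∑ j, f i j := by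
    rw [← Equiv.sum_comp σ fun i => ∑ j, f i j]
    exact Finset.sum_congr rfl fun i _ => Equiv.sum_comp σ (f (σ i))
  simp only [one_mul, hinv, Finset.sum_const, Finset.card_univ, nsmul_eq_mul, mul_one] at hone
  have hcard : (1 : ℝ) < Fintype.card α := by exact_mod_cast hα
  have h₀ : (Fintype.card α : ℝ) ≠ 0 := by linarith
  have h₁ : (Fintype.card α : ℝ) - 1 ≠ 0 := by linarith
  have hlam : ∑ i, ∑ j, lam i * lam j = 1 := by
    rw [← Finset.sum_mul_sum, hsum, one_mul]
  rw [hweighted, hlam, ← mul_assoc, ← mul_div_assoc, hone]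
  simp only [← sq]
  field_simp

end PermSum

/-- For Hermitian `X` and a real diagonal matrix `ρ`, the trace of `X ρ X ρ` is a quadratic form
in the diagonal entries of `ρ`. -/
theorem Matrix.IsHermitian.trace_mul_diagonal_mul_mul_diagonal {n : Type*} [Fintype n]
    [DecidableEq n] {X : Matrix n n ℂ} (hX : X.IsHermitian) (lam : n → ℝ) :
    trace (X * diagonal (fun i => (lam i : ℂ)) * X * diagonal (fun i => (lam i : ℂ))) =
      ((∑ i, ∑ j, lam i * lam j * Complex.normSq (X i j) : ℝ) : ℂ) := by
  push_cast
  rw [trace]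
  refine Finset.sum_congr rfl fun i _ => ?_
  rw [diag_apply, mul_diagonal, mul_apply, Finset.sum_mul]
  refine Finset.sum_congr rfl fun j _ => ?_
  rw [mul_diagonal, ← hX.apply j i, Complex.star_def, Complex.normSq_eq_conj_mul_self]
  ring

/-- For `N ≥ 2`, `X` Hermitian with vanishing diagonal, and `ρ = diag(λ)`
a density matrix, there exists a permutation `σ` with
`Tr[X^σ ρ X^σ ρ] ≥ (Tr[X²]/(N(N−1))) ⬝ (1 − Tr[ρ²])`, where `(X^σ)_{ij} = X_{σ(i)σ(j)}`.
(The inequality is stated in the canonical order on `ℂ`; all quantities involved are real.) -/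
theorem exists_perm_trace_ge (N : ℕ) (hN : 2 ≤ N)
    (X : Matrix (Fin N) (Fin N) ℂ) (hX : X.IsHermitian)
    (hdiag : ∀ i, X i i = 0)
    (lam : Fin N → ℝ) (hlam : ∀ i, 0 ≤ lam i) (hsum : ∑ i, lam i = 1)
    (ρ : Matrix (Fin N) (Fin N) ℂ)
    (hρ : ρ = Matrix.diagonal (fun i => (lam i : ℂ))) :
    ∃ σ : Equiv.Perm (Fin N),
      (Matrix.trace (X * X) / ((N : ℂ) * ((N : ℂ) - 1))) * (1 - Matrix.trace (ρ * ρ))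
        ≤ Matrix.trace ((Matrix.of fun i j => X (σ i) (σ j)) * ρ *
            (Matrix.of fun i j => X (σ i) (σ j)) * ρ) := by
  have hXX : trace (X * X) = ((∑ i, ∑ j, Complex.normSq (X i j) : ℝ) : ℂ) := by
    simpa using hX.trace_mul_diagonal_mul_mul_diagonal fun _ => 1
  have hρρ : trace (ρ * ρ) = ((∑ i, lam i ^ 2 : ℝ) : ℂ) := by
    simp [hρ, trace_diagonal, sq]
  have havg := sum_perm_quadratic (fun i j => Complex.normSq (X i j)) (by simp [hdiag])
    (by rw [Fintype.card_fin]; omega) lam hsum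
  obtain ⟨σ, -, hσ⟩ := Finset.exists_le_of_sum_le
    (f := fun _ : Equiv.Perm (Fin N) =>
      (∑ i, ∑ j, Complex.normSq (X i j)) / (N * ((N : ℝ) - 1)) * (1 - ∑ i, lam i ^ 2))
    (g := fun σ => ∑ i, ∑ j, lam i * lam j * Complex.normSq (X (σ i) (σ j)))
    Finset.univ_nonempty (by
      rw [havg, Finset.sum_const, Finset.card_univ, nsmul_eq_mul, Fintype.card_fin])
  refine ⟨σ, ?_⟩
  have hXσ : (Matrix.of fun i j => X (σ i) (σ j)).IsHermitian := hX.submatrix σ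
  rw [hXX, hρρ, hρ, hXσ.trace_mul_diagonal_mul_mul_diagonal]
  exact_mod_cast hσ
end

section
/- Let γ > 0, t > 0 and N ≥ 1 be real numbers, and define f(v) = exp(−4γt(v − 1/(2N))²) and g(v) = exp(−4γt(v + 1/(2N))²). Then ∫_{−∞}^{∞} 2√(γt/π) · f(v)g(v)/(f(v)+g(v)) dv = (e^{−γt/N²}/√(8πt)) · ∫_{−∞}^{∞} e^{−x²/(2t)} / cosh(√(2γ)·x/N) dx. -/
open MeasureTheory Real

/-- For equal-width Gaussian-type weights `exp (b + d)` and `exp (b - d)`, the ratio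
`f g / (f + g)` is `exp b / (2 cosh d)`. -/
lemma exp_mul_exp_div_exp_add_exp (b d : ℝ) :
    Real.exp (b + d) * Real.exp (b - d) / (Real.exp (b + d) + Real.exp (b - d)) =
      Real.exp b / (2 * Real.cosh d) := by
  have hd : Real.exp d * Real.exp (-d) = 1 := by rw [← Real.exp_add]; simp
  have h1 : Real.exp d + Real.exp (-d) ≠ 0 := by positivity
  rw [Real.cosh_eq, sub_eq_add_neg, Real.exp_add, Real.exp_add, ← mul_add]
  field_simp
  linear_combination hd

/-- With `f(v) = exp(−4γt(v − 1/(2N))²)` and `g(v) = exp(−4γt(v + 1/(2N))²)`,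
the average impurity of the two-state measurement satisfies
`∫ 2√(γt/π) f g/(f+g) dv = (e^{−γt/N²}/√(8πt)) ∫ e^{−x²/(2t)}/cosh(√(2γ)x/N) dx`. -/
theorem average_impurity_closed_form (γ t N : ℝ) (hγ : 0 < γ) (ht : 0 < t) (hN : 1 ≤ N) :
    (∫ v : ℝ, 2 * Real.sqrt (γ * t / π) *
        (Real.exp (-4 * γ * t * (v - 1 / (2 * N)) ^ 2) *
          Real.exp (-4 * γ * t * (v + 1 / (2 * N)) ^ 2) /
          (Real.exp (-4 * γ * t * (v - 1 / (2 * N)) ^ 2) +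
            Real.exp (-4 * γ * t * (v + 1 / (2 * N)) ^ 2))))
      = (Real.exp (-γ * t / N ^ 2) / Real.sqrt (8 * π * t)) *
        ∫ x : ℝ, Real.exp (-x ^ 2 / (2 * t)) / Real.cosh (Real.sqrt (2 * γ) * x / N) := by
  have hN0 : N ≠ 0 := by positivity
  set s := Real.sqrt (2 * γ) with hs
  have hs2 : s ^ 2 = 2 * γ := Real.sq_sqrt (by positivity)
  have hs0 : 0 < s := Real.sqrt_pos.2 (by positivity)
  set F : ℝ → ℝ := fun x => Real.exp (-x ^ 2 / (2 * t)) / Real.cosh (s * x / N) with hF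
  have key : ∀ v : ℝ, 2 * Real.sqrt (γ * t / π) *
        (Real.exp (-4 * γ * t * (v - 1 / (2 * N)) ^ 2) *
          Real.exp (-4 * γ * t * (v + 1 / (2 * N)) ^ 2) /
          (Real.exp (-4 * γ * t * (v - 1 / (2 * N)) ^ 2) +
            Real.exp (-4 * γ * t * (v + 1 / (2 * N)) ^ 2)))
      = Real.sqrt (γ * t / π) * Real.exp (-γ * t / N ^ 2) * F (2 * s * t * v) := by
    intro v
    have hf : -4 * γ * t * (v - 1 / (2 * N)) ^ 2 =
        (-γ * t / N ^ 2 + -4 * γ * t * v ^ 2) + 4 * γ * t * v / N := by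
      field_simp
      ring
    have hg : -4 * γ * t * (v + 1 / (2 * N)) ^ 2 =
        (-γ * t / N ^ 2 + -4 * γ * t * v ^ 2) - 4 * γ * t * v / N := by
      field_simp
      ring
    have hexp : -(2 * s * t * v) ^ 2 / (2 * t) = -4 * γ * t * v ^ 2 := by
      field_simp
      linear_combination (-2 * v ^ 2) * hs2
    have hcosh : s * (2 * s * t * v) / N = 4 * γ * t * v / N := by
      congr 1
      linear_combination (2 * t * v) * hs2
    have hc := (Real.cosh_pos (4 * γ * t * v / N)).ne'
    rw [hf, hg, exp_mul_exp_div_exp_add_exp, hF]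
    simp only [hexp, hcosh]
    rw [Real.exp_add]
    field_simp
  have hsqrt : Real.sqrt (γ * t / π) * Real.sqrt (8 * π * t) = 2 * s * t := by
    rw [← Real.sqrt_mul (by positivity), ← Real.sqrt_sq (by positivity : 0 ≤ 2 * s * t)]
    congr 1
    field_simp
    linear_combination -4 * hs2
  have h8 : 0 < Real.sqrt (8 * π * t) := Real.sqrt_pos.2 (by positivity)
  simp_rw [key]
  rw [integral_const_mul, Measure.integral_comp_mul_left F, abs_of_pos (by positivity),
    smul_eq_mul, ← hsqrt]
  have hq : 0 < Real.sqrt (γ * t / π) := Real.sqrt_pos.2 (by positivity)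
  generalize Real.sqrt (γ * t / π) = q at *
  generalize Real.sqrt (8 * π * t) = r at *
  field_simp
end

section
/- Let N ≥ 2 and let λ₁ ≥ λ₂ ≥ λ₃ ≥ … ≥ λ_N ≥ 0 be real numbers with ∑_{i=1}^N λ_i = 1 and λ₁ + λ₂ > 0. Then (λ₁² + λ₂²)/(λ₁ + λ₂)² ≥ ∑_{i=1}^N λ_i². -/
open BigOperators

/-- For eigenvalues `λ₁ ≥ λ₂ ≥ … ≥ λ_N ≥ 0` of a density matrix
(`∑ λᵢ = 1`) with `λ₁ + λ₂ > 0`, truncating to the two largest eigenvalues and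
renormalizing increases the purity: `(λ₁² + λ₂²)/(λ₁ + λ₂)² ≥ ∑ᵢ λᵢ²`. -/
theorem truncation_increases_purity (N : ℕ) (hN : 2 ≤ N) (lam : Fin N → ℝ)
    (hmono : ∀ i j : Fin N, i ≤ j → lam j ≤ lam i)
    (hnonneg : ∀ i, 0 ≤ lam i)
    (hsum : ∑ i, lam i = 1)
    (hpos : 0 < lam ⟨0, by omega⟩ + lam ⟨1, by omega⟩) :
    ∑ i, (lam i) ^ 2 ≤
      ((lam ⟨0, by omega⟩) ^ 2 + (lam ⟨1, by omega⟩) ^ 2) /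
        (lam ⟨0, by omega⟩ + lam ⟨1, by omega⟩) ^ 2 := by
  obtain ⟨n, rfl⟩ := Nat.exists_eq_add_of_le' hN
  have h0 : (⟨0, by omega⟩ : Fin (n + 2)) = 0 := rfl
  have h1 : (⟨1, by omega⟩ : Fin (n + 2)) = Fin.succ 0 := rfl
  simp only [h0, h1] at hpos ⊢
  rw [Fin.sum_univ_succ, Fin.sum_univ_succ] at hsum ⊢
  have hb : 0 ≤ lam (Fin.succ 0) := hnonneg _
  have hab : lam (Fin.succ 0) ≤ lam 0 := hmono _ _ (Fin.zero_le _)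
  have hrest : 0 ≤ ∑ i : Fin n, lam i.succ.succ := Finset.sum_nonneg fun i _ => hnonneg _
  have hsq : ∑ i : Fin n, lam i.succ.succ ^ 2 ≤
      lam (Fin.succ 0) * ∑ i : Fin n, lam i.succ.succ := by
    rw [Finset.mul_sum]
    refine Finset.sum_le_sum fun i _ => ?_
    rw [sq]
    exact mul_le_mul_of_nonneg_right
      (hmono _ _ (Fin.succ_le_succ_iff.mpr (Fin.zero_le _))) (hnonneg _)
  generalize lam 0 = a at *
  generalize lam (Fin.succ 0) = b at *
  generalize ∑ i : Fin n, lam i.succ.succ = r at *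
  obtain rfl : r = 1 - (a + b) := by linarith
  refine (show _ ≤ a ^ 2 + b ^ 2 + b * (1 - (a + b)) by linarith).trans ?_
  rw [le_div_iff₀ (by positivity)]
  have hcubic : 0 ≤ a * (a - b) * (a + b) :=
    mul_nonneg (mul_nonneg (hb.trans hab) (sub_nonneg.mpr hab)) hpos.le
  have key : 0 ≤ (1 - (a + b)) * (a ^ 2 + b ^ 2 + a * (a - b) * (a + b)) :=
    mul_nonneg hrest (by positivity)
  linear_combination key
end
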